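/- arXiv:2305.16090 — 2 statements merged into one kernel-verified Lean document; each statement's English description precedes it below -/
import Mathlib

section
/- Fix δ > 0. For every real number r one has |−(1/2)·f_δ(r) − r⁻| ≤ (4/27)·δ, where r⁻ = max(−r,0); in particular the functions −(1/2)f_δ converge uniformly on ℝ to the negative-part function as δ → 0⁺. -/
/-- Pardoux's `C²` approximation `F_δ` of the squared negative part. -/
noncomputable def Fdelta (δ r : ℝ) : ℝ :=
  if r ≤ -δ then r ^ 2 - δ ^ 2 / 6
  else if r ≤ 0 then -r ^ 4 / (2 * δ ^ 2) - 4 * r ^ 3 / (3 * δ)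
  else 0

/-- The first derivative `F_δ'` of `F_δ`. -/
noncomputable def fdelta (δ r : ℝ) : ℝ :=
  if r ≤ -δ then 2 * r
  else if r ≤ 0 then -2 * r ^ 3 / δ ^ 2 - 4 * r ^ 2 / δ
  else 0

/-- The second derivative `F_δ''` of `F_δ`. -/
noncomputable def gdelta (δ r : ℝ) : ℝ :=
  if r ≤ -δ then 2
  else if r ≤ 0 then -6 * r ^ 2 / δ ^ 2 - 8 * r / δ
  else 0

theorem mul_one_sub_sq_le {t : ℝ} (ht : t ≤ 1) : t * (1 - t) ^ 2 ≤ 4 / 27 := by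
  nlinarith [mul_nonneg (sq_nonneg (t - 1 / 3)) (show (0 : ℝ) ≤ 4 / 3 - t by linarith)]

/-- On the transition interval, the error of `-(1/2)·f_δ` is a rescaled cubic. -/
theorem neg_half_fdelta_sub_neg {δ r : ℝ} (hδ : 0 < δ) (h₁ : -δ < r) (h₂ : r ≤ 0) :
    -(1 / 2) * fdelta δ r - -r = -(δ * (-r / δ * (1 - -r / δ) ^ 2)) := by
  rw [fdelta, if_neg h₁.not_ge, if_pos h₂]
  field_simp
  ring

/-- For every `δ > 0` and every real `r`, `|-(1/2)·f_δ r - r⁻| ≤ (4/27)·δ`,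
where `r⁻ = max (-r) 0`; so `-(1/2)·f_δ` converges uniformly to the negative
part as `δ → 0⁺`. -/
theorem half_fdelta_unif_approx_neg_part (δ : ℝ) (hδ : 0 < δ) (r : ℝ) :
    |-(1 / 2) * fdelta δ r - max (-r) 0| ≤ (4 / 27) * δ := by
  have hbound : 0 ≤ 4 / 27 * δ := by positivity
  rcases le_or_gt r (-δ) with h₁ | h₁
  · rw [fdelta, if_pos h₁, max_eq_left (by linarith)]
    ring_nf
    simpa [mul_comm] using hbound
  rcases le_or_gt r 0 with h₂ | h₂
  · have ht₀ : 0 ≤ -r / δ := div_nonneg (by linarith) hδ.le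
    have ht₁ : -r / δ ≤ 1 := (div_le_one hδ).2 (by linarith)
    rw [max_eq_left (by linarith), neg_half_fdelta_sub_neg hδ h₁ h₂, abs_neg,
      abs_of_nonneg (by positivity), mul_comm]
    exact mul_le_mul_of_nonneg_right (mul_one_sub_sq_le ht₁) hδ.le
  · rw [fdelta, if_neg h₁.not_ge, if_neg h₂.not_ge, max_eq_right (by linarith)]
    simpa using hbound
end

section
/- Fix 1 < p < 2 and p' = p/(p−1), and let α = (p'−1)/(p')^p, i.e. the unique α > 0 with p' − (p')^p·α = 1. Then for every M > 0 and every real x with x ≤ −M one has (−x)·|φ_M(x)| − α·|φ_M(x)|^p ≥ 0, where φ_M(x) = p'·M^{p'−2}·((p'−1)x + (p'−2)M) for x ≤ −M. -/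
/-- The truncated power function `F_M` from Lemma 3.6 (with `q = p' = p/(p-1)`). -/
noncomputable def FM (q M x : ℝ) : ℝ :=
  if 0 ≤ x then 0
  else if -M ≤ x then (-x) ^ q
  else (q * (q - 1) / 2) * M ^ (q - 2) * (x + M) ^ 2
        - q * M ^ (q - 1) * (x + M) + M ^ q

/-- The first derivative `F_M' = φ_M` of `F_M`. -/
noncomputable def phiM (q M x : ℝ) : ℝ :=
  if 0 ≤ x then 0
  else if -M ≤ x then -q * (-x) ^ (q - 1)
  else q * M ^ (q - 2) * ((q - 1) * x + (q - 2) * M)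

/-- The second derivative `F_M'' = ψ_M` of `F_M`. -/
noncomputable def psiM (q M x : ℝ) : ℝ :=
  if 0 ≤ x then 0
  else if -M ≤ x then q * (q - 1) * (-x) ^ (q - 2)
  else q * (q - 1) * M ^ (q - 2)

/-- Below `-M`, including at `-M` itself, `φ_M` is given by its affine branch. -/
theorem phiM_of_le_neg {q M x : ℝ} (hM : 0 < M) (hx : x ≤ -M) :
    phiM q M x = q * M ^ (q - 2) * ((q - 1) * x + (q - 2) * M) := by
  have h0 : ¬ 0 ≤ x := by linarith
  rcases hx.lt_or_eq with h | rfl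
  · simp [phiM, h0, h.not_ge]
  · have hpow : M ^ (q - 1) = M ^ (q - 2) * M := by
      rw [← Real.rpow_add_one hM.ne']
      ring_nf
    simp only [phiM, h0, if_false, le_refl, if_true, neg_neg, hpow]
    ring

/-- For `1 < p < 2` and `p' = p/(p-1)`, `p' - 1` is the inverse of `p - 1`, and weighted AM-GM
bounds the `(p-1)`-th power of the normalized affine branch of `φ_M` by `-x`. -/
theorem rpow_affine_le {p q M y : ℝ} (hp1 : 1 < p) (hp2 : p < 2)
    (hqp : (q - 1) * (p - 1) = 1) (hM : 0 < M)
    (hB : 0 ≤ (q - 1) * y - (q - 2) * M) :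
    (M ^ (q - 2) * ((q - 1) * y - (q - 2) * M)) ^ (p - 1) ≤ y := by
  have hexp : (q - 2) * (p - 1) = 2 - p := by linarith
  rw [Real.mul_rpow (by positivity) hB, ← Real.rpow_mul hM.le, hexp]
  calc _ ≤ (2 - p) * M + (p - 1) * ((q - 1) * y - (q - 2) * M) :=
        Real.geom_mean_le_arith_mean2_weighted (by linarith) (by linarith) hM.le hB (by ring)
    _ = y := by linear_combination (y - M) * hqp

/-- For `1 < p < 2`, `p' = p/(p-1)` and `α = (p'-1)/(p')^p` (the unique `α > 0`
with `p' - (p')^p·α = 1`): for every `M > 0` and every `x ≤ -M`,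
`(-x)·|φ_M x| - α·|φ_M x|^p ≥ 0`. -/
theorem phiM_tail_nonneg (p q α : ℝ) (hp1 : 1 < p) (hp2 : p < 2)
    (hq : q = p / (p - 1)) (hα : α = (q - 1) / q ^ p) :
    ∀ M : ℝ, 0 < M → ∀ x : ℝ, x ≤ -M →
      (-x) * |phiM q M x| - α * |phiM q M x| ^ p ≥ 0 := by
  intro M hM x hx
  have hp : 0 < p - 1 := by linarith
  have hqp : (q - 1) * (p - 1) = 1 := by
    rw [hq]
    field_simp
    ring
  have hq1 : 0 < q - 1 := pos_of_mul_pos_left (by rw [hqp]; exact one_pos) hp.le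
  have hq0 : 0 < q := by linarith
  have hB : 0 < (q - 1) * (-x) - (q - 2) * M := by nlinarith
  set C := M ^ (q - 2) * ((q - 1) * (-x) - (q - 2) * M) with hC
  have hC0 : 0 < C := by positivity
  have habs : |phiM q M x| = q * C := by
    rw [phiM_of_le_neg hM hx, ← abs_neg, ← abs_of_pos (mul_pos hq0 hC0), hC]
    ring_nf
  have hle : C ^ (p - 1) ≤ -x := rpow_affine_le hp1 hp2 hqp hM hB.le
  have hpow : C ^ p = C ^ (p - 1) * C := by
    rw [← Real.rpow_add_one hC0.ne', sub_add_cancel]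
  have hqpow : q ^ p ≠ 0 := (Real.rpow_pos_of_pos hq0 p).ne'
  have hα' : α * (q * C) ^ p = (q - 1) * (C ^ (p - 1) * C) := by
    rw [hα, Real.mul_rpow hq0.le hC0.le, hpow]
    field_simp
  rw [habs, hα', ge_iff_le, sub_nonneg]
  calc (q - 1) * (C ^ (p - 1) * C) ≤ q * (-x * C) := by
        gcongr
        linarith
    _ = -x * (q * C) := by ring
end
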